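/- arXiv:0809.3271 — 2 statements merged into one kernel-verified Lean document; each statement's English description precedes it below -/
import Mathlib

section
/- Heat-kernel Wiener lemma on the d-dimensional torus: for any probability measure μ on 𝕋^d = ℝ^d/ℤ^d, lim_{t→0⁺} ( Σ_{k∈ℤ^d} |μ̂(k)|² e^{-4π²‖k‖²t} ) / ( Σ_{k∈ℤ^d} e^{-4π²‖k‖²t} ) = Σ_{x∈𝕋^d} μ({x})². -/
open MeasureTheory Filter Topology Real

namespace WienerHeat

/-- one-dimensional heat weight -/
noncomputable def a (t : ℝ) (n : ℤ) : ℝ := Real.exp (-4 * π ^ 2 * (n : ℝ) ^ 2 * t)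

lemma a_pos (t : ℝ) (n : ℤ) : 0 < a t n := Real.exp_pos _

lemma a_zero (t : ℝ) : a t 0 = 1 := by simp [a]

lemma a_neg (t : ℝ) (n : ℤ) : a t (-n) = a t n := by simp [a]

lemma summable_a {t : ℝ} (ht : 0 < t) : Summable (a t) := by
  have h := summable_pow_mul_jacobiTheta₂_term_bound 0 (T := 4 * π * t) (by positivity) 0
  refine h.congr fun n => ?_
  simp only [a, pow_zero, one_mul]
  congr 1
  ring

lemma summable_af {t : ℝ} (ht : 0 < t) (u : UnitAddCircle) :
    Summable (fun n : ℤ => ‖(a t n : ℂ) * fourier n u‖) := by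
  refine (summable_a ht).congr fun n => ?_
  have : ‖(fourier n u : ℂ)‖ = 1 := Circle.norm_coe _
  rw [norm_mul, this, mul_one, Complex.norm_real, Real.norm_of_nonneg (a_pos t n).le]

lemma tsum_a_pos {t : ℝ} (ht : 0 < t) : 0 < ∑' n, a t n :=
  (summable_a ht).tsum_pos (fun n => (a_pos t n).le) 0 (a_pos t 0)

lemma hasSum_diff_nat {t : ℝ} (ht : 0 < t) :
    HasSum (fun n : ℕ => |a t (n : ℤ) - a t ((n : ℤ) + 1)|) 1 := by
  have hle : ∀ n : ℕ, a t ((n : ℤ) + 1) ≤ a t (n : ℤ) := by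
    intro n
    unfold a
    apply Real.exp_le_exp.2
    push_cast
    have h1 : 0 ≤ π ^ 2 * t := by positivity
    have h2 : (0 : ℝ) ≤ n := Nat.cast_nonneg n
    nlinarith [mul_nonneg h1 h2]
  rw [hasSum_iff_tendsto_nat_of_nonneg (fun n => abs_nonneg _)]
  have hs : ∀ N : ℕ, ∑ i ∈ Finset.range N, |a t (i : ℤ) - a t ((i : ℤ) + 1)| = 1 - a t (N : ℤ) := by
    intro N
    rw [← a_zero t]
    have := Finset.sum_range_sub' (fun i : ℕ => a t (i : ℤ)) N
    simp only [Nat.cast_zero] at this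
    rw [← this]
    refine Finset.sum_congr rfl fun i _ => ?_
    rw [abs_of_nonneg (sub_nonneg.2 (hle i))]
    push_cast
    rfl
  simp_rw [hs]
  have h0 : Tendsto (fun N : ℕ => a t (N : ℤ)) atTop (𝓝 0) :=
    ((summable_a ht).comp_injective Nat.cast_injective).tendsto_atTop_zero
  simpa using h0.const_sub 1

lemma hasSum_diff {t : ℝ} (ht : 0 < t) :
    HasSum (fun n : ℤ => |a t n - a t (n + 1)|) 2 := by
  have h := HasSum.of_nat_of_neg_add_one (f := fun n : ℤ => |a t n - a t (n + 1)|)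
    (hasSum_diff_nat ht) (m' := 1) (by
      refine (hasSum_diff_nat ht).congr_fun ?_
      intro n
      have h1 : -((n : ℤ) + 1) + 1 = -(n : ℤ) := by ring
      rw [h1, a_neg, a_neg, abs_sub_comm])
  norm_num at h
  exact h

lemma norm_theta_aux {t : ℝ} (ht : 0 < t) (z : ℂ) (φ : ℤ → ℂ) (h1 : ∀ n, ‖φ n‖ = 1)
    (hφ : ∀ n, φ (n + 1) = φ n * z) :
    ‖1 - z‖ * ‖∑' n : ℤ, (a t n : ℂ) * φ n‖ ≤ 2 := by
  have hs : Summable (fun n : ℤ => (a t n : ℂ) * φ n) := by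
    refine Summable.of_norm ((summable_a ht).congr fun n => ?_)
    rw [norm_mul, h1, mul_one, Complex.norm_real, Real.norm_of_nonneg (a_pos t n).le]
  have hs' : Summable (fun n : ℤ => (a t (n + 1) : ℂ) * φ (n + 1)) :=
    hs.comp_injective (add_left_injective (1 : ℤ))
  have e1 : ∑' n : ℤ, (a t (n + 1) : ℂ) * φ (n + 1) = ∑' n : ℤ, (a t n : ℂ) * φ n :=
    (Equiv.addRight (1 : ℤ)).tsum_eq (fun n : ℤ => (a t n : ℂ) * φ n)
  have key : (1 - z) * ∑' n : ℤ, (a t n : ℂ) * φ n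
      = - ∑' n : ℤ, ((a t n - a t (n + 1) : ℝ) : ℂ) * φ (n + 1) := by
    rw [sub_mul, one_mul]
    nth_rewrite 1 [← e1]
    rw [← tsum_mul_left, ← hs'.tsum_sub (hs.mul_left _), ← tsum_neg]
    refine tsum_congr fun n => ?_
    rw [hφ]
    push_cast
    ring
  rw [← norm_mul, key, norm_neg]
  refine tsum_of_norm_bounded (hasSum_diff ht) fun n => ?_
  rw [norm_mul, h1, mul_one, Complex.norm_real, Real.norm_eq_abs]

lemma norm_theta_le {t : ℝ} (ht : 0 < t) (u : UnitAddCircle) :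
    ‖1 - (fourier 1 u : ℂ)‖ * ‖∑' n : ℤ, (a t n : ℂ) * fourier n u‖ ≤ 2 :=
  norm_theta_aux ht (fourier 1 u) (fun n => fourier n u) (fun _ => Circle.norm_coe _)
    (fun _ => fourier_add)

lemma tendsto_tsum_a : Tendsto (fun t : ℝ => ∑' n, a t n) (𝓝[>] 0) atTop := by
  rw [tendsto_atTop]
  intro C
  obtain ⟨N, hN⟩ := exists_nat_gt C
  have h1 : Tendsto (fun t : ℝ => ∑ i ∈ Finset.range N, a t (i : ℤ)) (𝓝[>] 0) (𝓝 N) := by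
    have hc : Continuous (fun t : ℝ => ∑ i ∈ Finset.range N, a t (i : ℤ)) := by
      unfold a
      fun_prop
    have := (hc.tendsto 0).mono_left (nhdsWithin_le_nhds (s := Set.Ioi 0))
    simpa [a] using this
  filter_upwards [h1.eventually (lt_mem_nhds hN), self_mem_nhdsWithin] with t h ht
  refine h.le.trans ?_
  have := (summable_a ht).sum_le_tsum ((Finset.range N).map Nat.castEmbedding)
    (fun n _ => (a_pos t n).le)
  simpa using this

/-- normalized theta function -/
noncomputable def G (t : ℝ) (u : UnitAddCircle) : ℂ :=
  (∑' n : ℤ, (a t n : ℂ) * fourier n u) / ((∑' n, a t n : ℝ) : ℂ)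

lemma G_zero {t : ℝ} (ht : 0 < t) : G t 0 = 1 := by
  unfold G
  have : (∑' n : ℤ, (a t n : ℂ) * fourier n (0 : UnitAddCircle)) = ((∑' n, a t n : ℝ) : ℂ) := by
    rw [Complex.ofReal_tsum]
    refine tsum_congr fun n => ?_
    rw [fourier_eval_zero, mul_one]
  rw [this]
  exact div_self (by exact_mod_cast (tsum_a_pos ht).ne')

lemma norm_G_le {t : ℝ} (ht : 0 < t) (u : UnitAddCircle) : ‖G t u‖ ≤ 1 := by
  unfold G
  rw [norm_div, Complex.norm_real, Real.norm_of_nonneg (tsum_a_pos ht).le]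
  refine div_le_one_of_le₀ ?_ (tsum_a_pos ht).le
  refine tsum_of_norm_bounded (summable_a ht).hasSum fun n => ?_
  have : ‖(fourier n u : ℂ)‖ = 1 := Circle.norm_coe _
  rw [norm_mul, this, mul_one, Complex.norm_real, Real.norm_of_nonneg (a_pos t n).le]

lemma tendsto_G {u : UnitAddCircle} (hu : u ≠ 0) : Tendsto (fun t => G t u) (𝓝[>] 0) (𝓝 0) := by
  have hne : (fourier 1 u : ℂ) ≠ 1 := by
    intro h
    rw [fourier_one] at h
    apply hu
    apply AddCircle.injective_toCircle (T := 1) one_ne_zero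
    rw [AddCircle.toCircle_zero]
    exact Circle.ext (by rw [h, Circle.coe_one])
  have hc : 0 < ‖1 - (fourier 1 u : ℂ)‖ := norm_pos_iff.2 (sub_ne_zero.2 hne.symm)
  have hlim := (tendsto_tsum_a.inv_tendsto_atTop).const_mul (2 / ‖1 - (fourier 1 u : ℂ)‖)
  rw [mul_zero] at hlim
  refine squeeze_zero_norm' ?_ hlim
  filter_upwards [self_mem_nhdsWithin] with t ht
  unfold G
  rw [norm_div, Complex.norm_real, Real.norm_of_nonneg (tsum_a_pos ht).le, div_eq_mul_inv]
  refine mul_le_mul_of_nonneg_right ?_ (inv_nonneg.2 (tsum_a_pos ht).le)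
  rw [le_div_iff₀' hc]
  exact norm_theta_le ht u

lemma summable_tsum_pi (d : ℕ) (f : Fin d → ℤ → ℂ) (hf : ∀ j, Summable (fun n => ‖f j n‖)) :
    Summable (fun k : Fin d → ℤ => ‖∏ j, f j (k j)‖) ∧
      ∑' k : Fin d → ℤ, ∏ j, f j (k j) = ∏ j, ∑' n, f j n := by
  induction d with
  | zero => exact ⟨Summable.of_finite, by simp⟩
  | succ d ih =>
    obtain ⟨h1, h2⟩ := ih (fun j => f j.succ) (fun j => hf j.succ)
    constructor
    · rw [← (Fin.consEquiv (fun _ => ℤ)).summable_iff]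
      refine (Summable.mul_norm (hf 0) h1).congr fun p => ?_
      simp [Fin.consEquiv, Fin.prod_univ_succ]
    · rw [← (Fin.consEquiv (fun _ => ℤ)).tsum_eq, Fin.prod_univ_succ, ← h2,
        tsum_mul_tsum_of_summable_norm (hf 0) h1]
      refine tsum_congr fun p => ?_
      simp [Fin.consEquiv, Fin.prod_univ_succ]

lemma exp_eq_prod {d : ℕ} (k : Fin d → ℤ) (t : ℝ) :
    Real.exp (-4 * π ^ 2 * (∑ j, (k j : ℝ) ^ 2) * t) = ∏ j, a t (k j) := by
  unfold a
  rw [← Real.exp_sum, Finset.mul_sum, Finset.sum_mul]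

lemma tsum_exp {d : ℕ} {t : ℝ} (ht : 0 < t) :
    ((∑' k : Fin d → ℤ, Real.exp (-4 * π ^ 2 * (∑ j, (k j : ℝ) ^ 2) * t) : ℝ) : ℂ)
      = ∏ _j : Fin d, ((∑' n, a t n : ℝ) : ℂ) := by
  have h := (summable_tsum_pi d (fun _ n => (a t n : ℂ)) (fun _ => by
    simpa [abs_of_pos (a_pos t _)] using summable_a ht)).2
  simp only [Complex.ofReal_tsum, exp_eq_prod, Complex.ofReal_prod]
  exact h

lemma prod_G {d : ℕ} {t : ℝ} (ht : 0 < t) (u : Fin d → UnitAddCircle) :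
    ∏ j, G t (u j) = (∑' k : Fin d → ℤ, ∏ j, ((a t (k j) : ℂ) * fourier (k j) (u j))) /
      ∏ _j : Fin d, ((∑' n, a t n : ℝ) : ℂ) := by
  rw [(summable_tsum_pi d (fun j n => (a t n : ℂ) * fourier n (u j))
    (fun j => summable_af ht (u j))).2]
  unfold G
  rw [Finset.prod_div_distrib]

lemma norm_sq_eq {d : ℕ} (μ : Measure (Fin d → UnitAddCircle)) [IsProbabilityMeasure μ]
    (k : Fin d → ℤ) :
    ((‖∫ x, ∏ j, fourier (-(k j)) (x j) ∂μ‖ ^ 2 : ℝ) : ℂ) =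
      ∫ p, ∏ j, fourier (k j) (p.2 j - p.1 j) ∂(μ.prod μ) := by
  have h1 : ∀ p : (Fin d → UnitAddCircle) × (Fin d → UnitAddCircle),
      ∏ j, (fourier (k j) (p.2 j - p.1 j) : ℂ) =
      (∏ j, (fourier (-(k j)) (p.1 j) : ℂ)) *
        (starRingEnd ℂ) (∏ j, (fourier (-(k j)) (p.2 j) : ℂ)) := by
    intro p
    rw [map_prod, ← Finset.prod_mul_distrib]
    refine Finset.prod_congr rfl fun j _ => ?_
    rw [← fourier_neg, neg_neg, mul_comm]
    simp only [fourier_apply]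
    rw [← Circle.coe_mul, ← AddCircle.toCircle_add, smul_sub, neg_smul, sub_eq_add_neg]
  simp_rw [h1]
  rw [integral_prod_mul (fun x : Fin d → UnitAddCircle => ∏ j, (fourier (-(k j)) (x j) : ℂ))
    (fun x : Fin d → UnitAddCircle => (starRingEnd ℂ) (∏ j, (fourier (-(k j)) (x j) : ℂ))),
    integral_conj, Complex.mul_conj, Complex.normSq_eq_norm_sq]

lemma integral_prod_G {d : ℕ} (μ : Measure (Fin d → UnitAddCircle)) [IsProbabilityMeasure μ]
    {t : ℝ} (ht : 0 < t) :
    (((∑' k : Fin d → ℤ,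
            ‖∫ x, ∏ j, fourier (-(k j)) (x j) ∂μ‖ ^ 2 *
              Real.exp (-4 * π ^ 2 * (∑ j, (k j : ℝ) ^ 2) * t)) /
        (∑' k : Fin d → ℤ, Real.exp (-4 * π ^ 2 * (∑ j, (k j : ℝ) ^ 2) * t)) : ℝ) : ℂ) =
      ∫ p, ∏ j, G t (p.2 j - p.1 j) ∂(μ.prod μ) := by
  simp_rw [fun p : (Fin d → UnitAddCircle) × (Fin d → UnitAddCircle) =>
    prod_G ht (fun j => p.2 j - p.1 j)]
  rw [integral_div, Complex.ofReal_div, tsum_exp ht]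
  congr 1
  have hn : ∀ (k : Fin d → ℤ) (p : (Fin d → UnitAddCircle) × (Fin d → UnitAddCircle)),
      ‖∏ j, ((a t (k j) : ℂ) * fourier (k j) (p.2 j - p.1 j))‖ = ‖∏ j, (a t (k j) : ℂ)‖ := by
    intro k p
    rw [norm_prod, norm_prod]
    refine Finset.prod_congr rfl fun j _ => ?_
    have : ‖(fourier (k j) (p.2 j - p.1 j) : ℂ)‖ = 1 := Circle.norm_coe _
    rw [norm_mul, this, mul_one]
  have hcont : ∀ k : Fin d → ℤ, Continuous
      (fun p : (Fin d → UnitAddCircle) × (Fin d → UnitAddCircle) =>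
        ∏ j, ((a t (k j) : ℂ) * fourier (k j) (p.2 j - p.1 j))) := by
    intro k
    refine continuous_finsetProd _ fun j _ => continuous_const.mul
      ((fourier (k j)).continuous.comp ?_)
    fun_prop
  have hS := hasSum_integral_of_summable_integral_norm (μ := μ.prod μ)
    (F := fun (k : Fin d → ℤ) (p : (Fin d → UnitAddCircle) × (Fin d → UnitAddCircle)) =>
        ∏ j, ((a t (k j) : ℂ) * fourier (k j) (p.2 j - p.1 j)))
    (fun k => Integrable.of_bound (hcont k).aestronglyMeasurable ‖∏ j, (a t (k j) : ℂ)‖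
      (Eventually.of_forall fun p => (hn k p).le))
    (by
      simp_rw [hn]
      simp only [integral_const, probReal_univ, one_smul]
      exact (summable_tsum_pi d (fun _ n => (a t n : ℂ)) (fun _ => by
        simpa [abs_of_pos (a_pos t _)] using summable_a ht)).1)
  rw [← hS.tsum_eq, Complex.ofReal_tsum]
  refine tsum_congr fun k => ?_
  rw [Complex.ofReal_mul, norm_sq_eq, exp_eq_prod, mul_comm, Complex.ofReal_prod,
    ← integral_const_mul]
  simp_rw [Finset.prod_mul_distrib]

lemma prod_diagonal {d : ℕ} (μ : Measure (Fin d → UnitAddCircle)) [IsProbabilityMeasure μ] :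
    (μ.prod μ).real (Set.diagonal (Fin d → UnitAddCircle)) =
      ∑' x : Fin d → UnitAddCircle, (μ {x}).toReal ^ 2 := by
  have hS : (Function.support fun x => μ {x}).Countable := by
    have := Measure.countable_meas_pos_of_disjoint_iUnion (μ := μ)
      (As := fun x : Fin d → UnitAddCircle => {x}) (fun x => measurableSet_singleton x)
      (fun x y h => by simpa using h)
    simpa [pos_iff_ne_zero, Function.support] using this
  have h1 : (μ.prod μ) (Set.diagonal (Fin d → UnitAddCircle)) = ∑' x, μ {x} ^ 2 := by
    rw [Measure.prod_apply measurableSet_diagonal]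
    have : ∀ x : Fin d → UnitAddCircle, Prod.mk x ⁻¹' Set.diagonal (Fin d → UnitAddCircle) = {x} := by
      intro x
      ext y
      simp [eq_comm]
    simp_rw [this]
    rw [← setLIntegral_eq_of_support_subset (subset_refl _), lintegral_countable _ hS]
    simp_rw [← sq]
    refine tsum_subtype_eq_of_support_subset (f := fun x => μ {x} ^ 2) ?_
    intro x hx
    simp only [Function.mem_support, ne_eq] at hx ⊢
    intro h
    simp [h] at hx
  rw [Measure.real, h1, ENNReal.tsum_toReal_eq (fun x => by finiteness)]
  simp_rw [ENNReal.toReal_pow]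

end WienerHeat

open WienerHeat

/-- heat-kernel Wiener lemma on the `d`-dimensional torus, where
`μ̂(k) = ∫ e^{-2πi⟨k,x⟩} dμ(x)` is written as the integral of the product of the
one-dimensional characters `fourier (-(k j))`. -/
theorem wiener_heat_torus (d : ℕ) (μ : Measure (Fin d → UnitAddCircle))
    [IsProbabilityMeasure μ] :
    Tendsto (fun t : ℝ =>
        (∑' k : Fin d → ℤ,
            ‖∫ x, ∏ j, fourier (-(k j)) (x j) ∂μ‖ ^ 2 *
              Real.exp (-4 * π ^ 2 * (∑ j, (k j : ℝ) ^ 2) * t)) /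
        (∑' k : Fin d → ℤ, Real.exp (-4 * π ^ 2 * (∑ j, (k j : ℝ) ^ 2) * t)))
      (𝓝[>] (0 : ℝ))
      (𝓝 (∑' x : Fin d → UnitAddCircle, (μ {x}).toReal ^ 2)) := by
  rw [← prod_diagonal]
  have hI : ∫ p, (Set.diagonal (Fin d → UnitAddCircle)).indicator (fun _ => (1 : ℂ)) p ∂(μ.prod μ)
      = (((μ.prod μ).real (Set.diagonal (Fin d → UnitAddCircle)) : ℝ) : ℂ) := by
    rw [integral_indicator_const _ measurableSet_diagonal]
    simp
  have hGc : ∀ t : ℝ, 0 < t → Continuous (G t) := by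
    intro t ht
    unfold G
    refine Continuous.div_const ?_ _
    refine continuous_tsum (u := a t) (fun n => continuous_const.mul (fourier n).continuous)
      (summable_a ht) fun n u => ?_
    have : ‖(fourier n u : ℂ)‖ = 1 := Circle.norm_coe _
    rw [norm_mul, this, mul_one, Complex.norm_real, Real.norm_of_nonneg (a_pos t n).le]
  have hD : Tendsto (fun t : ℝ => ∫ p, ∏ j, G t (p.2 j - p.1 j) ∂(μ.prod μ)) (𝓝[>] 0)
      (𝓝 (∫ p, (Set.diagonal (Fin d → UnitAddCircle)).indicator (fun _ => (1 : ℂ)) p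
        ∂(μ.prod μ))) := by
    refine tendsto_integral_filter_of_dominated_convergence (fun _ => 1) ?_ ?_
      (integrable_const _) ?_
    · filter_upwards [self_mem_nhdsWithin] with t ht
      refine Continuous.aestronglyMeasurable ?_
      refine continuous_finsetProd _ fun j _ => (hGc t ht).comp ?_
      fun_prop
    · filter_upwards [self_mem_nhdsWithin] with t ht
      refine Eventually.of_forall fun p => ?_
      rw [norm_prod]
      exact Finset.prod_le_one (fun _ _ => norm_nonneg _) fun j _ => norm_G_le ht _
    · refine Eventually.of_forall fun p => ?_
      by_cases hp : p.1 = p.2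
      · rw [Set.indicator_of_mem (by exact hp)]
        refine tendsto_const_nhds.congr' ?_
        filter_upwards [self_mem_nhdsWithin] with t ht
        simp [hp, G_zero ht]
      · rw [Set.indicator_of_notMem (by exact hp)]
        obtain ⟨j, hj⟩ := Function.ne_iff.1 hp
        have hj' : p.2 j - p.1 j ≠ 0 := sub_ne_zero.2 (Ne.symm hj)
        refine squeeze_zero_norm' ?_ (tendsto_zero_iff_norm_tendsto_zero.1 (tendsto_G hj'))
        filter_upwards [self_mem_nhdsWithin] with t ht
        rw [norm_prod, ← Finset.mul_prod_erase _ _ (Finset.mem_univ j)]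
        exact mul_le_of_le_one_right (norm_nonneg _)
          (Finset.prod_le_one (fun _ _ => norm_nonneg _) fun j _ => norm_G_le ht _)
  rw [hI] at hD
  have hR := (Complex.continuous_re.tendsto _).comp hD
  rw [Complex.ofReal_re] at hR
  refine hR.congr' ?_
  filter_upwards [self_mem_nhdsWithin] with t ht
  rw [Function.comp_apply, ← integral_prod_G μ ht, Complex.ofReal_re]
end

section
/- A probability measure μ on 𝕋^d is continuous (atomless) if and only if lim_{t→0⁺} ( Σ_{k∈ℤ^d} |μ̂(k)|² e^{-4π²‖k‖²t} ) / ( Σ_{k∈ℤ^d} e^{-4π²‖k‖²t} ) = 0. -/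
open MeasureTheory Filter Topology Real

lemma wh_prod_tsum (d : ℕ) : ∀ (f : Fin d → ℤ → ℂ) (_ : ∀ j, Summable fun n => ‖f j n‖),
    (Summable fun k : Fin d → ℤ => ‖∏ j, f j (k j)‖) ∧
      ∑' k : Fin d → ℤ, ∏ j, f j (k j) = ∏ j, ∑' n, f j n := by
  induction d with
  | zero =>
    intro f _
    constructor
    · exact (hasSum_fintype _).summable
    · simp
  | succ d ih =>
    intro f hf
    obtain ⟨h1, h2⟩ := ih (fun j => f j.succ) (fun j => hf j.succ)
    have hs : Summable fun p : ℤ × (Fin d → ℤ) => ‖f 0 p.1 * ∏ j, f (Fin.succ j) (p.2 j)‖ :=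
      Summable.mul_norm (f := f 0) (g := fun k : Fin d → ℤ => ∏ j, f (Fin.succ j) (k j)) (hf 0) h1
    let e : ℤ × (Fin d → ℤ) ≃ (Fin (d + 1) → ℤ) := Fin.consEquiv (fun _ => ℤ)
    have he : ∀ p, ∏ j, f j (e p j) = f 0 p.1 * ∏ j, f (Fin.succ j) (p.2 j) := by
      intro p
      rw [Fin.prod_univ_succ]
      rfl
    constructor
    · rw [← e.summable_iff]
      refine hs.congr fun p => ?_
      rw [Function.comp_apply, he]
    · rw [← e.tsum_eq, Fin.prod_univ_succ, ← h2, tsum_mul_tsum_of_summable_norm (f := f 0)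
        (g := fun k : Fin d → ℤ => ∏ j, f (Fin.succ j) (k j)) (hf 0) h1]
      exact tsum_congr he

lemma wh_summable_gauss {c : ℝ} (hc : 0 < c) : Summable fun n : ℤ => rexp (-c * (n : ℝ) ^ 2) := by
  have h := ((summable_jacobiTheta₂_term_iff 0 (Complex.I * (c / π : ℝ))).2
    (by simp; positivity)).norm
  refine h.congr fun n => ?_
  rw [norm_jacobiTheta₂_term]
  congr 1
  simp
  field_simp

noncomputable def whG (t : ℝ) (n : ℤ) : ℝ := rexp (-4 * π ^ 2 * (n : ℝ) ^ 2 * t)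

lemma whG_pos (t : ℝ) (n : ℤ) : 0 < whG t n := Real.exp_pos _

lemma whG_summable {t : ℝ} (ht : 0 < t) : Summable (whG t) := by
  refine (wh_summable_gauss (c := 4 * π ^ 2 * t) (by positivity)).congr fun n => ?_
  rw [whG]; congr 1; ring

noncomputable def whS (t : ℝ) : ℝ := ∑' n, whG t n

lemma whS_pos {t : ℝ} (ht : 0 < t) : 0 < whS t :=
  (whG_summable ht).tsum_pos (fun n => (whG_pos t n).le) 0 (whG_pos t 0)

noncomputable def whPhi (t : ℝ) (z : UnitAddCircle) : ℂ := ∑' n : ℤ, (whG t n : ℂ) * fourier (-n) z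

lemma wh_term_norm (t : ℝ) (z : UnitAddCircle) (n : ℤ) :
    ‖(whG t n : ℂ) * fourier (-n) z‖ = whG t n := by
  rw [norm_mul, Complex.norm_real, Real.norm_of_nonneg (whG_pos t n).le, fourier_apply,
    Circle.norm_coe, mul_one]

lemma wh_term_summable {t : ℝ} (ht : 0 < t) (z : UnitAddCircle) :
    Summable fun n => ‖(whG t n : ℂ) * fourier (-n) z‖ := by
  simp_rw [wh_term_norm]; exact whG_summable ht

lemma whPhi_norm_le {t : ℝ} (ht : 0 < t) (z : UnitAddCircle) : ‖whPhi t z‖ ≤ whS t := by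
  refine (norm_tsum_le_tsum_norm (wh_term_summable ht z)).trans ?_
  simp_rw [wh_term_norm]; exact le_rfl

lemma whPhi_zero (t : ℝ) : whPhi t 0 = whS t := by
  simp [whPhi, whS, Complex.ofReal_tsum]

lemma whPhi_poisson {t : ℝ} (ht : 0 < t) (x : ℝ) :
    whPhi t (x : UnitAddCircle) = 1 / ((4 * π * t : ℝ) : ℂ) ^ (1 / 2 : ℂ) *
      ((∑' n : ℤ, rexp (-(1 / (4 * t)) * ((n : ℝ) + x) ^ 2) : ℝ) : ℂ) := by
  have h := Complex.tsum_exp_neg_quadratic (a := ((4 * π * t : ℝ) : ℂ))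
    (by rw [Complex.ofReal_re]; positivity) (-Complex.I * x)
  have e1 : whPhi t (x : UnitAddCircle) = ∑' n : ℤ, Complex.exp (-π * ((4 * π * t : ℝ) : ℂ) * n ^ 2
      + 2 * π * (-Complex.I * x) * n) := by
    refine tsum_congr fun n => ?_
    rw [whG, fourier_coe_apply, Complex.ofReal_exp, ← Complex.exp_add]
    congr 1
    push_cast
    ring
  rw [e1, h, Complex.ofReal_tsum]
  congr 1
  refine tsum_congr fun n => ?_
  rw [Complex.ofReal_exp]
  congr 1
  have hI : Complex.I * (-Complex.I * x) = x := by
    rw [← mul_assoc, mul_neg, Complex.I_mul_I]; simp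
  rw [hI]
  push_cast
  have : (t : ℂ) ≠ 0 := by exact_mod_cast ht.ne'
  have : (π : ℂ) ≠ 0 := by exact_mod_cast Real.pi_ne_zero
  field_simp

lemma wh_shift_summable {t : ℝ} (ht : 0 < t) (x : ℝ) :
    Summable fun n : ℤ => rexp (-(1 / (4 * t)) * ((n : ℝ) + x) ^ 2) := by
  have h := (wh_summable_gauss (c := 1 / (8 * t)) (by positivity)).mul_left
    (rexp (1 / (4 * t) * x ^ 2))
  refine h.of_nonneg_of_le (fun n => (Real.exp_pos _).le) fun n => ?_
  rw [← Real.exp_add, Real.exp_le_exp]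
  have : 0 ≤ (1 / (8 * t)) * ((n : ℝ) + 2 * x) ^ 2 := by positivity
  have e : 1 / (4 * t) = 2 * (1 / (8 * t)) := by field_simp; norm_num
  rw [e]
  nlinarith

lemma whPhi_tendsto {z : UnitAddCircle} (hz : z ≠ 0) :
    Tendsto (fun t : ℝ => whPhi t z / whS t) (𝓝[>] 0) (𝓝 0) := by
  obtain ⟨x, rfl⟩ := QuotientAddGroup.mk_surjective z
  have hx : ∀ n : ℤ, (n : ℝ) + x ≠ 0 := by
    intro n hn
    apply hz
    have : x = ((-n : ℤ) : ℝ) := by push_cast; linarith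
    change ((x : ℝ) : UnitAddCircle) = 0
    rw [AddCircle.coe_eq_zero_iff]
    exact ⟨-n, by rw [this]; simp⟩
  have hN : Tendsto (fun t : ℝ => ∑' n : ℤ, rexp (-(1 / (4 * t)) * ((n : ℝ) + x) ^ 2))
      (𝓝[>] 0) (𝓝 (∑' n : ℤ, 0)) := by
    refine tendsto_tsum_of_dominated_convergence (wh_shift_summable one_pos x) ?_ ?_
    · intro n
      have hp : 0 < ((n : ℝ) + x) ^ 2 / 4 := by
        have := hx n
        positivity
      have h1 := (tendsto_inv_nhdsGT_zero (𝕜 := ℝ)).const_mul_atTop hp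
      refine (Real.tendsto_exp_neg_atTop_nhds_zero.comp h1).congr fun t => ?_
      simp only [Function.comp]
      congr 1
      rw [one_div, mul_inv]; ring
    · have : Set.Ioo (0 : ℝ) 1 ∈ 𝓝[>] (0 : ℝ) := Ioo_mem_nhdsGT one_pos
      filter_upwards [this] with t ht n
      rw [Real.norm_of_nonneg (Real.exp_pos _).le, Real.exp_le_exp]
      have : 1 / (4 * 1) ≤ 1 / (4 * t) :=
        one_div_le_one_div_of_le (by linarith [ht.1]) (by linarith [ht.2])
      nlinarith [sq_nonneg ((n : ℝ) + x)]
  rw [tsum_zero] at hN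
  refine squeeze_zero_norm' ?_ hN
  filter_upwards [self_mem_nhdsWithin] with t ht
  have ht : 0 < t := ht
  rw [← whPhi_zero]
  have h0 := whPhi_poisson ht 0
  rw [QuotientAddGroup.mk_zero] at h0
  rw [h0]
  change ‖whPhi t ((x : ℝ) : UnitAddCircle) / _‖ ≤ _
  rw [whPhi_poisson ht x, mul_div_mul_left, ← Complex.ofReal_div, Complex.norm_real,
    Real.norm_of_nonneg]
  · apply div_le_self (tsum_nonneg fun n => (Real.exp_pos _).le)
    have := (wh_shift_summable ht 0).le_tsum 0 (fun n _ => (Real.exp_pos _).le)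
    simpa using this
  · exact div_nonneg (tsum_nonneg fun n => (Real.exp_pos _).le)
      (tsum_nonneg fun n => (Real.exp_pos _).le)
  · have : ((4 * π * t : ℝ) : ℂ) ≠ 0 := by
      have : (4 * π * t : ℝ) ≠ 0 := by positivity
      exact_mod_cast this
    simp only [one_div, ne_eq, inv_eq_zero, Complex.cpow_eq_zero_iff, not_and_or]
    left; exact this


lemma wh_weight {d : ℕ} (t : ℝ) (k : Fin d → ℤ) :
    rexp (-4 * π ^ 2 * (∑ j, (k j : ℝ) ^ 2) * t) = ∏ j, whG t (k j) := by
  simp only [whG]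
  rw [← Real.exp_sum, Finset.mul_sum, Finset.sum_mul]

lemma wh_denom {d : ℕ} {t : ℝ} (ht : 0 < t) :
    ∑' k : Fin d → ℤ, rexp (-4 * π ^ 2 * (∑ j, (k j : ℝ) ^ 2) * t) = whS t ^ d := by
  have h := (wh_prod_tsum d (fun _ n => (whG t n : ℂ) * fourier (-n) (0 : UnitAddCircle))
    (fun _ => wh_term_summable ht 0)).2
  have h' : ∀ n : ℤ, (whG t n : ℂ) * fourier (-n) (0 : UnitAddCircle) = (whG t n : ℂ) := by
    intro n; simp
  simp only [h', ← Complex.ofReal_tsum, ← Complex.ofReal_prod] at h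
  simp_rw [wh_weight]
  rw [Complex.ofReal_inj] at h
  rw [h]
  simp [whS]

lemma wh_fourier_sub (n : ℤ) (x y : UnitAddCircle) :
    fourier n (x - y) = fourier n x * (starRingEnd ℂ) (fourier n y) := by
  rw [← fourier_neg]
  simp only [fourier_apply]
  rw [smul_sub, sub_eq_add_neg, AddCircle.toCircle_add, neg_smul, Circle.coe_mul]

lemma wh_char_cont {d : ℕ} (k : Fin d → ℤ) :
    Continuous fun p : (Fin d → UnitAddCircle) × (Fin d → UnitAddCircle) =>
      ∏ j, (fourier (-(k j)) (p.1 j - p.2 j) : ℂ) := by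
  fun_prop

lemma wh_sq {d : ℕ} (μ : Measure (Fin d → UnitAddCircle)) [IsProbabilityMeasure μ]
    (k : Fin d → ℤ) :
    ((‖∫ x, ∏ j, (fourier (-(k j)) (x j) : ℂ) ∂μ‖ ^ 2 : ℝ) : ℂ) =
      ∫ p, ∏ j, (fourier (-(k j)) (p.1 j - p.2 j) : ℂ) ∂(μ.prod μ) := by
  rw [Complex.ofReal_pow, ← Complex.mul_conj', ← integral_conj, ← integral_prod_mul]
  refine integral_congr_ae (Eventually.of_forall fun p => ?_)
  simp only [wh_fourier_sub, Finset.prod_mul_distrib, map_prod]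

lemma wh_numer {d : ℕ} (μ : Measure (Fin d → UnitAddCircle)) [IsProbabilityMeasure μ]
    {t : ℝ} (ht : 0 < t) :
    ((∑' k : Fin d → ℤ, ‖∫ x, ∏ j, (fourier (-(k j)) (x j) : ℂ) ∂μ‖ ^ 2 *
      rexp (-4 * π ^ 2 * (∑ j, (k j : ℝ) ^ 2) * t) : ℝ) : ℂ) =
      ∫ p, ∏ j, whPhi t (p.1 j - p.2 j) ∂(μ.prod μ) := by
  have hprod := fun p : (Fin d → UnitAddCircle) × (Fin d → UnitAddCircle) =>
    wh_prod_tsum d (fun j n => (whG t n : ℂ) * fourier (-n) (p.1 j - p.2 j))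
      (fun j => wh_term_summable ht _)
  have hR : ∫ p, ∏ j, whPhi t (p.1 j - p.2 j) ∂(μ.prod μ) = ∫ p, ∑' k : Fin d → ℤ,
      ∏ j, ((whG t (k j) : ℂ) * fourier (-(k j)) (p.1 j - p.2 j)) ∂(μ.prod μ) := by
    refine integral_congr_ae (Eventually.of_forall fun p => ?_)
    exact (hprod p).2.symm
  have hnorm : ∀ (k : Fin d → ℤ) (p : (Fin d → UnitAddCircle) × (Fin d → UnitAddCircle)),
      ‖∏ j, ((whG t (k j) : ℂ) * fourier (-(k j)) (p.1 j - p.2 j))‖ = ∏ j, whG t (k j) := by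
    intro k p
    rw [norm_prod]
    exact Finset.prod_congr rfl fun j _ => wh_term_norm _ _ _
  have hint : ∀ k : Fin d → ℤ, Integrable (fun p : (Fin d → UnitAddCircle) ×
      (Fin d → UnitAddCircle) => ∏ j, ((whG t (k j) : ℂ) * fourier (-(k j)) (p.1 j - p.2 j)))
      (μ.prod μ) := by
    intro k
    refine Integrable.of_bound (C := ∏ j, whG t (k j)) ?_ ?_
    · exact Continuous.aestronglyMeasurable (by fun_prop)
    · exact Eventually.of_forall fun p => (hnorm k p).le
  rw [hR, ← integral_tsum_of_summable_integral_norm hint, Complex.ofReal_tsum]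
  · refine tsum_congr fun k => ?_
    rw [Complex.ofReal_mul, wh_sq, wh_weight, mul_comm, ← integral_const_mul]
    refine integral_congr_ae (Eventually.of_forall fun p => ?_)
    simp only [Finset.prod_mul_distrib, Complex.ofReal_prod]
  · simp only [hnorm, integral_const, probReal_univ, one_smul]
    refine (hprod 0).1.congr fun k => ?_
    exact hnorm k 0

lemma wh_prod_tendsto {d : ℕ} (p : (Fin d → UnitAddCircle) × (Fin d → UnitAddCircle)) :
    Tendsto (fun t : ℝ => ∏ j, (whPhi t (p.1 j - p.2 j) / whS t)) (𝓝[>] 0)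
      (𝓝 ((Set.diagonal (Fin d → UnitAddCircle)).indicator (fun _ => (1 : ℂ)) p)) := by
  by_cases hp : p.1 = p.2
  · have hm : p ∈ Set.diagonal (Fin d → UnitAddCircle) := hp
    rw [Set.indicator_of_mem hm]
    refine tendsto_const_nhds.congr' ?_
    filter_upwards [self_mem_nhdsWithin] with t ht
    have h0 : (whS t : ℂ) ≠ 0 := by exact_mod_cast (whS_pos ht).ne'
    symm
    refine Finset.prod_eq_one fun j _ => ?_
    rw [hp, sub_self, whPhi_zero, div_self h0]
  · have hm : p ∉ Set.diagonal (Fin d → UnitAddCircle) := hp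
    rw [Set.indicator_of_notMem hm]
    obtain ⟨i, hi⟩ := Function.ne_iff.1 hp
    have htend := (whPhi_tendsto (sub_ne_zero.2 hi)).norm
    rw [norm_zero] at htend
    refine squeeze_zero_norm' ?_ htend
    filter_upwards [self_mem_nhdsWithin] with t ht
    have hle : ∀ z, ‖whPhi t z / whS t‖ ≤ 1 := fun z => by
      rw [norm_div, Complex.norm_real, Real.norm_of_nonneg (whS_pos ht).le,
        div_le_one (whS_pos ht)]
      exact whPhi_norm_le ht z
    rw [norm_prod, ← Finset.mul_prod_erase _ _ (Finset.mem_univ i)]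
    exact mul_le_of_le_one_right (norm_nonneg _)
      (Finset.prod_le_one (fun _ _ => norm_nonneg _) fun _ _ => hle _)

lemma wh_limit {d : ℕ} (μ : Measure (Fin d → UnitAddCircle)) [IsProbabilityMeasure μ] :
    Tendsto (fun t : ℝ =>
        (∑' k : Fin d → ℤ,
            ‖∫ x, ∏ j, fourier (-(k j)) (x j) ∂μ‖ ^ 2 *
              Real.exp (-4 * π ^ 2 * (∑ j, (k j : ℝ) ^ 2) * t)) /
        (∑' k : Fin d → ℤ, Real.exp (-4 * π ^ 2 * (∑ j, (k j : ℝ) ^ 2) * t)))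
      (𝓝[>] (0 : ℝ)) (𝓝 ((μ.prod μ).real (Set.diagonal _))) := by
  have hmeas : MeasurableSet (Set.diagonal (Fin d → UnitAddCircle)) :=
    isClosed_diagonal.measurableSet
  have hcont : ∀ t : ℝ, 0 < t → Continuous (whPhi t) := by
    intro t ht
    refine continuous_tsum (fun n => by fun_prop) (whG_summable ht) fun n z => ?_
    exact (wh_term_norm t z n).le
  have key : Tendsto (fun t : ℝ => ∫ p, ∏ j, (whPhi t (p.1 j - p.2 j) / whS t) ∂(μ.prod μ))
      (𝓝[>] 0) (𝓝 (∫ p, (Set.diagonal (Fin d → UnitAddCircle)).indicator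
        (fun _ => (1 : ℂ)) p ∂(μ.prod μ))) := by
    refine tendsto_integral_filter_of_dominated_convergence (fun _ => 1) ?_ ?_
      (integrable_const _) (Eventually.of_forall wh_prod_tendsto)
    · filter_upwards [self_mem_nhdsWithin] with t ht
      have := hcont t ht
      exact Continuous.aestronglyMeasurable (by fun_prop)
    · filter_upwards [self_mem_nhdsWithin] with t ht
      refine Eventually.of_forall fun p => ?_
      rw [norm_prod]
      refine Finset.prod_le_one (fun _ _ => norm_nonneg _) fun j _ => ?_
      rw [norm_div, Complex.norm_real, Real.norm_of_nonneg (whS_pos ht).le,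
        div_le_one (whS_pos ht)]
      exact whPhi_norm_le ht _
  rw [integral_indicator_const _ hmeas] at key
  have key2 := (Complex.continuous_re.tendsto _).comp key
  simp only [Complex.real_smul, mul_one, Complex.ofReal_re] at key2
  refine key2.congr' ?_
  filter_upwards [self_mem_nhdsWithin] with t ht
  rw [wh_denom ht, ← Complex.ofReal_re (_ / _), Complex.ofReal_div, wh_numer μ ht,
    ← integral_div]
  simp [Finset.prod_div_distrib]

/-- a probability measure on `𝕋^d` is continuous (atomless) iff its
normalized heat-kernel quadratic averages tend to `0` as `t → 0⁺`. -/
theorem continuous_iff_wiener_heat_torus (d : ℕ) (μ : Measure (Fin d → UnitAddCircle))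
    [IsProbabilityMeasure μ] :
    (∀ x : Fin d → UnitAddCircle, μ {x} = 0) ↔
    Tendsto (fun t : ℝ =>
        (∑' k : Fin d → ℤ,
            ‖∫ x, ∏ j, fourier (-(k j)) (x j) ∂μ‖ ^ 2 *
              Real.exp (-4 * π ^ 2 * (∑ j, (k j : ℝ) ^ 2) * t)) /
        (∑' k : Fin d → ℤ, Real.exp (-4 * π ^ 2 * (∑ j, (k j : ℝ) ^ 2) * t)))
      (𝓝[>] (0 : ℝ)) (𝓝 0) := by
  have hmeas : MeasurableSet (Set.diagonal (Fin d → UnitAddCircle)) :=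
    isClosed_diagonal.measurableSet
  have hpre : ∀ x : Fin d → UnitAddCircle,
      Prod.mk x ⁻¹' (Set.diagonal (Fin d → UnitAddCircle)) = {x} := by
    intro x; ext y; simp [eq_comm]
  have hnull : (μ.prod μ) (Set.diagonal _) = 0 ↔ ∀ᵐ x ∂μ, μ {x} = 0 := by
    rw [Measure.measure_prod_null hmeas]
    simp only [EventuallyEq, hpre, Pi.zero_apply]
  have hlim := wh_limit μ
  constructor
  · intro h
    have h0 := hnull.2 (Eventually.of_forall h)
    rwa [measureReal_def, h0, ENNReal.toReal_zero] at hlim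
  · intro h x
    have h0 := tendsto_nhds_unique hlim h
    rw [measureReal_eq_zero_iff] at h0
    have h1 := hnull.1 h0
    by_contra hx
    exact hx (measure_mono_null (by
      intro y hy
      rw [Set.mem_singleton_iff.1 hy]
      exact hx) h1)
end
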